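/- Fix a prime p. Let K be a finite extension of ℚ_p, K̄ an algebraic closure of K, and C the completion of K̄ with respect to the unique absolute value extending the p-adic absolute value; each element of G_K = Gal(K̄/K) acts isometrically on K̄ and hence extends uniquely to a continuous field automorphism of C. Then the fixed field of this action is exactly K: C^{G_K} = K. -/

import Mathlib

open Polynomial in
/-- In a product of linear factors `X - a` with all `‖a‖ ≤ r`, the coefficients are bounded by
the corresponding powers of `r`. -/
theorem norm_coeff_prod_X_sub_C_le {L : Type*} [NormedField L] [IsUltrametricDist L] {r : ℝ}
    (hr : 0 ≤ r) (s : Multiset L) (hs : ∀ a ∈ s, ‖a‖ ≤ r) (i : ℕ) :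
    ‖(s.map fun a => X - C a).prod.coeff i‖ ≤ r ^ (s.card - i) := by
  induction s using Multiset.induction_on generalizing i with
  | empty =>
    simp only [Multiset.map_zero, Multiset.prod_zero, coeff_one]
    split_ifs <;> simp
  | cons a s ih =>
    have ih' := ih fun b hb => hs b (Multiset.mem_cons_of_mem hb)
    have ha := hs a (Multiset.mem_cons_self a s)
    rw [Multiset.map_cons, Multiset.prod_cons, Multiset.card_cons, sub_mul]
    cases i with
    | zero =>
      rw [coeff_sub, mul_coeff_zero, coeff_X_zero, zero_mul, zero_sub, norm_neg, coeff_C_mul,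
        norm_mul, Nat.sub_zero, pow_succ']
      exact mul_le_mul ha (ih' 0) (norm_nonneg _) hr
    | succ i =>
      rw [coeff_sub, coeff_X_mul, coeff_C_mul, Nat.add_sub_add_right]
      rw [sub_eq_add_neg]
      refine (IsUltrametricDist.norm_add_le_max _ _).trans (max_le (ih' i) ?_)
      rw [norm_neg]
      by_cases h : i + 1 ≤ s.card
      · rw [norm_mul, show s.card - i = (s.card - (i + 1)) + 1 by omega, pow_succ']
        exact mul_le_mul ha (ih' _) (norm_nonneg _) hr
      · rw [coeff_eq_zero_of_natDegree_lt, mul_zero, norm_zero]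
        · positivity
        · rw [natDegree_multiset_prod_X_sub_C_eq_card]
          omega

open Polynomial in
/-- If all roots of a monic split polynomial are within distance `r` of `x`, its Hasse derivatives
at `x` are bounded by powers of `r`. -/
theorem norm_eval_hasseDeriv_le {L : Type*} [NormedField L] [IsUltrametricDist L] {r : ℝ}
    (hr : 0 ≤ r) {f : L[X]} (hf : f.Monic) (hsplit : f.Splits) {x : L}
    (hroots : ∀ y ∈ f.roots, ‖y - x‖ ≤ r) (q : ℕ) :
    ‖(hasseDeriv q f).eval x‖ ≤ r ^ (f.natDegree - q) := by
  have htaylor : taylor x f = ((f.roots.map (· - x)).map fun a => X - C a).prod := by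
    conv_lhs => rw [hsplit.eq_prod_roots_of_monic hf, ← taylorAlgHom_apply, map_multiset_prod]
    rw [Multiset.map_map, Multiset.map_map]
    congr 1
    refine Multiset.map_congr rfl fun y _ => ?_
    simp only [Function.comp_apply, taylorAlgHom_apply, map_sub, taylor_X, taylor_C]
    ring
  have h := norm_coeff_prod_X_sub_C_le hr (f.roots.map (· - x))
    (Multiset.forall_mem_map_iff.2 hroots) q
  rwa [← htaylor, taylor_coeff, Multiset.card_map, ← hsplit.natDegree_eq_card_roots] at h

theorem pow_card_le_norm_prod {L : Type*} [NormedField L] {c : ℝ} (hc : 0 ≤ c)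
    (s : Multiset L) (hs : ∀ a ∈ s, c ≤ ‖a‖) : c ^ s.card ≤ ‖s.prod‖ := by
  induction s using Multiset.induction_on with
  | empty => simp
  | cons a s ih =>
    rw [Multiset.card_cons, Multiset.prod_cons, norm_mul, pow_succ']
    exact mul_le_mul (hs a (Multiset.mem_cons_self a s))
      (ih fun b hb => hs b (Multiset.mem_cons_of_mem hb)) (by positivity) (norm_nonneg _)

open Polynomial in
/-- A nonconstant split polynomial has a root close to `x`, as measured by its value at `x`. -/
theorem exists_root_norm_sub_pow_le {L : Type*} [NormedField L] {g : L[X]} (hsplit : g.Splits)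
    (hdeg : g.natDegree ≠ 0) (x : L) :
    ∃ y, g.IsRoot y ∧ ‖x - y‖ ^ g.natDegree * ‖g.leadingCoeff‖ ≤ ‖g.eval x‖ := by
  classical
  have hg : g ≠ 0 := by
    rintro rfl
    simp at hdeg
  have hne : g.roots.toFinset.Nonempty := by
    rw [Multiset.toFinset_nonempty, ← Multiset.card_pos, ← hsplit.natDegree_eq_card_roots]
    omega
  obtain ⟨y, hy, hmin⟩ := Finset.exists_min_image _ (fun y => ‖x - y‖) hne
  refine ⟨y, (mem_roots hg).1 (Multiset.mem_toFinset.1 hy), ?_⟩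
  have h := pow_card_le_norm_prod (norm_nonneg (x - y)) (g.roots.map (x - ·))
    (by simpa [hg] using hmin)
  rw [Multiset.card_map, ← hsplit.natDegree_eq_card_roots] at h
  rw [hsplit.eval_eq_prod_roots, norm_mul, mul_comm]
  gcongr

open Polynomial in
theorem hasseDeriv_map_ringHom {R S : Type*} [Semiring R] [Semiring S] (φ : R →+* S) (q : ℕ)
    (f : R[X]) : hasseDeriv q (f.map φ) = (hasseDeriv q f).map φ := by
  ext i
  simp [hasseDeriv_coeff]

open Polynomial in
/-- Ax's root estimate for the Hasse derivatives of a minimal polynomial. -/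
theorem exists_natDegree_minpoly_lt_and_norm_sub_pow_le {K L : Type*} [Field K] [CharZero K]
    [NormedField L] [IsUltrametricDist L] [IsAlgClosed L] [Algebra K L] [Normal K L]
    {x : L} {r : ℝ} (hr : ∀ σ : L ≃ₐ[K] L, ‖σ x - x‖ ≤ r) {q : ℕ} (hq : q ≠ 0)
    (hqn : q < (minpoly K x).natDegree) :
    ∃ y : L, (minpoly K y).natDegree < (minpoly K x).natDegree ∧
      ‖x - y‖ ^ ((minpoly K x).natDegree - q) * ‖((minpoly K x).natDegree.choose q : L)‖ ≤
        r ^ ((minpoly K x).natDegree - q) := by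
  have hx : IsIntegral K x := Normal.isIntegral ‹_› x
  have hr0 : 0 ≤ r := (norm_nonneg _).trans (hr 1)
  set f := minpoly K x with hf
  have hmonic : f.Monic := minpoly.monic hx
  have hdeg : (hasseDeriv q f).natDegree = f.natDegree - q := natDegree_hasseDeriv f q
  have hlead : (hasseDeriv q f).leadingCoeff = (f.natDegree.choose q : K) := by
    rw [leadingCoeff, hdeg, hasseDeriv_coeff, Nat.sub_add_cancel hqn.le, hmonic.coeff_natDegree,
      mul_one]
  obtain ⟨y, hy, hle⟩ := exists_root_norm_sub_pow_le
    (IsAlgClosed.splits ((hasseDeriv q f).map (algebraMap K L)))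
    (by rw [natDegree_map, hdeg]; omega) x
  refine ⟨y, ?_, ?_⟩
  · have h0 : hasseDeriv q f ≠ 0 := by
      intro h
      rw [h, natDegree_zero] at hdeg
      omega
    have hdvd : minpoly K y ∣ hasseDeriv q f :=
      minpoly.dvd K y (by rwa [IsRoot, eval_map_algebraMap] at hy)
    have := natDegree_le_of_dvd hdvd h0
    omega
  · rw [natDegree_map, hdeg, leadingCoeff_map, hlead, map_natCast, ← hasseDeriv_map_ringHom] at hle
    refine hle.trans ?_
    rw [← natDegree_map (p := f) (algebraMap K L)]
    refine norm_eval_hasseDeriv_le hr0 (hmonic.map _) (IsAlgClosed.splits _) ?_ q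
    intro z hz
    have hz' : IsConjRoot K x z := by
      rw [isConjRoot_iff_mem_minpoly_aroots hx]
      exact hz
    obtain ⟨σ, rfl⟩ := isConjRoot_iff_exists_algEquiv.1 hz'.symm
    exact hr σ

theorem not_dvd_choose_prime_pow_mul {p : ℕ} [Fact p.Prime] (k d : ℕ) (hd : ¬ p ∣ d) :
    ¬ p ∣ (p ^ k * d).choose (p ^ k) := by
  induction k with
  | zero => simpa using hd
  | succ k ih =>
    have hp : 0 < p := (Fact.out : p.Prime).pos
    have h := Choose.choose_modEq_choose_mod_mul_choose_div_nat (n := p ^ (k + 1) * d)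
      (k := p ^ (k + 1)) (p := p)
    rw [show p ^ (k + 1) * d = p * (p ^ k * d) by ring, pow_succ' p k, Nat.mul_mod_right,
      Nat.mul_mod_right, Nat.mul_div_cancel_left _ hp, Nat.mul_div_cancel_left _ hp,
      Nat.choose_self, one_mul] at h
    rw [show p ^ (k + 1) * d = p * (p ^ k * d) by ring, pow_succ' p k, h.dvd_iff dvd_rfl]
    exact ih

theorem norm_choose_prime_pow_succ {p : ℕ} [hp : Fact p.Prime] (k : ℕ) :
    ‖((p ^ (k + 1)).choose (p ^ k) : ℚ_[p])‖ = (p : ℝ)⁻¹ := by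
  have hle : p ^ k ≤ p ^ (k + 1) := Nat.pow_le_pow_right hp.out.pos k.le_succ
  have h := Nat.factorization_choose_prime_pow_add_factorization hp.out hle
    (pow_ne_zero k hp.out.ne_zero)
  rw [hp.out.factorization_pow, Finsupp.single_eq_same, add_comm k 1, Nat.add_right_cancel_iff,
    Nat.factorization_def _ hp.out] at h
  rw [Padic.norm_eq_zpow_neg_valuation (Nat.cast_ne_zero.2 (Nat.choose_pos hle).ne'),
    Padic.valuation_natCast, add_comm k 1, h]
  simp

/-- The constant in Ax's approximation theorem for elements of degree `n`. -/
noncomputable def axConstant (p n : ℕ) : ℝ := (p : ℝ) ^ (2 - 2 / (2 : ℝ) ^ Nat.log p n)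

theorem axConstant_mono {p m n : ℕ} (hp : 1 < p) (h : m ≤ n) :
    axConstant p m ≤ axConstant p n := by
  have hlog : Nat.log p m ≤ Nat.log p n := Nat.log_mono_right h
  refine Real.rpow_le_rpow_of_exponent_le (by exact_mod_cast hp.le) ?_
  gcongr
  norm_num

theorem one_le_axConstant {p : ℕ} (hp : 1 < p) (n : ℕ) : 1 ≤ axConstant p n := by
  refine le_trans ?_ (axConstant_mono hp n.zero_le)
  simp [axConstant]

theorem axConstant_le {p : ℕ} (hp : 1 < p) (n : ℕ) : axConstant p n ≤ (p : ℝ) ^ 2 := by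
  rw [axConstant, ← Real.rpow_natCast (p : ℝ) 2]
  refine Real.rpow_le_rpow_of_exponent_le (by exact_mod_cast hp.le) ?_
  rw [Nat.cast_ofNat, sub_le_self_iff]
  positivity

theorem axConstant_mul_le {p m k : ℕ} (hp : 1 < p) (hm : m < p ^ (k + 1)) :
    axConstant p m * (p : ℝ) ^ (((2 : ℝ) ^ k)⁻¹) ≤ axConstant p (p ^ (k + 1)) := by
  have hlog : Nat.log p m ≤ k := by
    rcases eq_or_ne m 0 with rfl | h0
    · simp
    · exact Nat.lt_succ_iff.1 (Nat.log_lt_of_lt_pow h0 hm)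
  have hp0 : (0 : ℝ) < p := by exact_mod_cast hp.le
  rw [axConstant, axConstant, Nat.log_pow hp, ← Real.rpow_add hp0]
  refine Real.rpow_le_rpow_of_exponent_le (by exact_mod_cast hp.le) ?_
  have h1 : ((2 : ℝ) ^ k)⁻¹ ≤ ((2 : ℝ) ^ Nat.log p m)⁻¹ := by
    gcongr
    norm_num
  have h2 : 2 / (2 : ℝ) ^ (k + 1) = ((2 : ℝ) ^ k)⁻¹ := by
    rw [pow_succ]
    field_simp
  rw [h2, div_eq_mul_inv]
  linarith

theorem le_rpow_mul_of_pow_mul_inv_le {p k : ℕ} (hp : 1 < p) {t r : ℝ} (hr : 0 ≤ r)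
    (h : t ^ (p ^ (k + 1) - p ^ k) * (p : ℝ)⁻¹ ≤ r ^ (p ^ (k + 1) - p ^ k)) :
    t ≤ (p : ℝ) ^ (((2 : ℝ) ^ k)⁻¹) * r := by
  have hp0 : (0 : ℝ) < p := by exact_mod_cast hp.le
  have hm : 2 ^ k ≤ p ^ (k + 1) - p ^ k := by
    have h2 : 2 ^ k ≤ p ^ k := Nat.pow_le_pow_left hp k
    have h3 : p ^ k * 2 ≤ p ^ k * p := Nat.mul_le_mul_left _ hp
    rw [pow_succ]
    omega
  set c : ℝ := (p : ℝ) ^ (((2 : ℝ) ^ k)⁻¹)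
  have hc : 1 ≤ c := Real.one_le_rpow (by exact_mod_cast hp.le) (by positivity)
  have hcp : (p : ℝ) ≤ c ^ (p ^ (k + 1) - p ^ k) := by
    refine le_trans (le_of_eq ?_) (pow_le_pow_right₀ hc hm)
    rw [← Real.rpow_natCast, ← Real.rpow_mul hp0.le]
    push_cast
    rw [inv_mul_cancel₀ (by positivity), Real.rpow_one]
  have hm0 : p ^ (k + 1) - p ^ k ≠ 0 := (lt_of_lt_of_le (by positivity) hm).ne'
  refine le_of_pow_le_pow_left₀ hm0 (by positivity) ?_
  rw [mul_pow]
  rw [mul_inv_le_iff₀ hp0] at h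
  nlinarith [pow_nonneg hr (p ^ (k + 1) - p ^ k)]

/-- Algebraic automorphisms of an algebraic normed extension of `ℚ_[p]` are isometric. -/
theorem norm_algEquiv_apply {p : ℕ} [Fact p.Prime] {K L : Type*} [Field K] [Algebra ℚ_[p] K]
    [NormedField L] [Algebra K L] [NormedAlgebra ℚ_[p] L] [IsScalarTower ℚ_[p] K L]
    [Algebra.IsAlgebraic ℚ_[p] L] (σ : L ≃ₐ[K] L) (x : L) : ‖σ x‖ = ‖x‖ := by
  rw [NormedAlgebra.norm_eq_spectralNorm (K := ℚ_[p]) x,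
    NormedAlgebra.norm_eq_spectralNorm (K := ℚ_[p]) (σ x)]
  exact (spectralNorm_eq_of_equiv (σ.restrictScalars ℚ_[p]) x).symm

/-- One step of Ax's descent: `x` can be approximated by an element of smaller degree. -/
theorem exists_natDegree_minpoly_lt_and_norm_sub_le (p : ℕ) [hp : Fact p.Prime] {K L : Type*}
    [Field K] [CharZero K] [NormedField L] [IsUltrametricDist L] [IsAlgClosed L] [Algebra K L]
    [Normal K L] [NormedAlgebra ℚ_[p] L] {x : L} {r : ℝ}
    (hr : ∀ σ : L ≃ₐ[K] L, ‖σ x - x‖ ≤ r) (hn : 1 < (minpoly K x).natDegree) :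
    ∃ (y : L) (c : ℝ), (minpoly K y).natDegree < (minpoly K x).natDegree ∧ 1 ≤ c ∧
      ‖x - y‖ ≤ c * r ∧
      axConstant p (minpoly K y).natDegree * c ≤ axConstant p (minpoly K x).natDegree := by
  have hr0 : 0 ≤ r := (norm_nonneg _).trans (hr 1)
  have hnorm (m : ℕ) : ‖(m : L)‖ = ‖(m : ℚ_[p])‖ := by
    rw [← map_natCast (algebraMap ℚ_[p] L), norm_algebraMap']
  obtain ⟨j, d, hd, hjd⟩ := Nat.exists_eq_pow_mul_and_not_dvd (n := (minpoly K x).natDegree)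
    (by omega) p hp.out.ne_one
  have hd0 : d ≠ 0 := by
    rintro rfl
    exact hd (dvd_zero p)
  have hpos (k : ℕ) : 0 < p ^ k := pow_pos hp.out.pos k
  by_cases hd1 : d = 1
  · rw [hd1, mul_one] at hjd
    obtain ⟨k, rfl⟩ : ∃ k, j = k + 1 := Nat.exists_eq_succ_of_ne_zero (by
      rintro rfl
      rw [hjd] at hn
      simp at hn)
    obtain ⟨y, hy, hle⟩ := exists_natDegree_minpoly_lt_and_norm_sub_pow_le hr (hpos k).ne'
      (by rw [hjd]; exact Nat.pow_lt_pow_right hp.out.one_lt k.lt_succ_self)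
    rw [hjd, hnorm, norm_choose_prime_pow_succ] at hle
    refine ⟨y, (p : ℝ) ^ (((2 : ℝ) ^ k)⁻¹), hy, ?_, ?_, ?_⟩
    · exact Real.one_le_rpow (by exact_mod_cast hp.out.one_lt.le) (by positivity)
    · exact le_rpow_mul_of_pow_mul_inv_le hp.out.one_lt hr0 hle
    · rw [hjd] at hy ⊢
      exact axConstant_mul_le hp.out.one_lt hy
  · have hlt : p ^ j < (minpoly K x).natDegree := by
      rw [hjd]
      exact lt_mul_of_one_lt_right (hpos j) (by omega)
    obtain ⟨y, hy, hle⟩ :=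
      exists_natDegree_minpoly_lt_and_norm_sub_pow_le hr (hpos j).ne' hlt
    have hunit : ‖((minpoly K x).natDegree.choose (p ^ j) : L)‖ = 1 := by
      rw [hnorm, Padic.norm_natCast_eq_one_iff, hp.out.coprime_iff_not_dvd, hjd]
      exact not_dvd_choose_prime_pow_mul j d hd
    rw [hunit, mul_one] at hle
    refine ⟨y, 1, hy, le_rfl, ?_, ?_⟩
    · rw [one_mul]
      exact le_of_pow_le_pow_left₀ (by omega) hr0 hle
    · rw [mul_one]
      exact axConstant_mono hp.out.one_lt hy.le

/-- **Ax's approximation theorem**: an element moved by at most `r` by every automorphism over `K`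
is within distance a constant times `r` of an element of `K`. -/
theorem exists_norm_sub_algebraMap_le (p : ℕ) [hp : Fact p.Prime] {K L : Type*}
    [Field K] [CharZero K] [Algebra ℚ_[p] K] [NormedField L] [IsUltrametricDist L] [IsAlgClosed L]
    [Algebra K L] [Normal K L] [NormedAlgebra ℚ_[p] L] [IsScalarTower ℚ_[p] K L]
    [Algebra.IsAlgebraic ℚ_[p] L] {x : L} {r : ℝ} (hr : ∀ σ : L ≃ₐ[K] L, ‖σ x - x‖ ≤ r) :
    ∃ a : K, ‖x - algebraMap K L a‖ ≤ axConstant p (minpoly K x).natDegree * r := by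
  induction hn : (minpoly K x).natDegree using Nat.strong_induction_on generalizing x r with
  | _ n ih =>
    have hr0 : 0 ≤ r := (norm_nonneg _).trans (hr 1)
    have hC (m : ℕ) := one_le_axConstant hp.out.one_lt m
    rcases le_or_gt n 1 with h1 | h1
    · have hpos := minpoly.natDegree_pos (Normal.isIntegral (F := K) ‹_› x)
      obtain ⟨a, rfl⟩ := minpoly.natDegree_eq_one_iff.1 (show (minpoly K x).natDegree = 1 by omega)
      refine ⟨a, ?_⟩
      rw [sub_self, norm_zero]
      exact mul_nonneg (zero_le_one.trans (hC n)) hr0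
    · subst hn
      obtain ⟨y, c, hy, hc, hxy, hle⟩ := exists_natDegree_minpoly_lt_and_norm_sub_le p hr h1
      have hy' (σ : L ≃ₐ[K] L) : ‖σ y - y‖ ≤ c * r := by
        have hσ : ‖σ (y - x)‖ ≤ c * r := by
          rwa [norm_algEquiv_apply (p := p), norm_sub_rev]
        have hx : ‖σ x - x‖ ≤ c * r := (hr σ).trans (le_mul_of_one_le_left hr0 hc)
        have h : σ y - y = σ (y - x) + ((σ x - x) + (x - y)) := by
          rw [map_sub]
          ring
        rw [h]
        exact (IsUltrametricDist.norm_add_le_max _ _).trans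
          (max_le hσ ((IsUltrametricDist.norm_add_le_max _ _).trans (max_le hx hxy)))
      obtain ⟨a, ha⟩ := ih _ hy hy' rfl
      refine ⟨a, ?_⟩
      rw [← sub_add_sub_cancel x y]
      have hcr : 0 ≤ c * r := by positivity
      have hbound : axConstant p (minpoly K y).natDegree * (c * r) ≤
          axConstant p (minpoly K x).natDegree * r := by
        rw [← mul_assoc]
        exact mul_le_mul_of_nonneg_right hle hr0
      exact (IsUltrametricDist.norm_add_le_max _ _).trans
        (max_le ((hxy.trans (le_mul_of_one_le_left hcr (hC _))).trans hbound) (ha.trans hbound))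

/-- A field homomorphism from a finite extension of `ℚ_[p]` to a normed field which extends the
`p`-adic norm has closed range. -/
theorem isClosed_range_of_norm_extends {p : ℕ} [Fact p.Prime] {K C : Type*} [Field K]
    [Algebra ℚ_[p] K] [FiniteDimensional ℚ_[p] K] [NormedField C] (φ : K →+* C)
    (hφ : ∀ a : ℚ_[p], ‖φ (algebraMap ℚ_[p] K a)‖ = ‖a‖) : IsClosed (Set.range φ) := by
  let : Algebra ℚ_[p] C := (φ.comp (algebraMap ℚ_[p] K)).toAlgebra
  let : NormedAlgebra ℚ_[p] C :=
    { norm_smul_le := fun a x => by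
        rw [Algebra.smul_def, norm_mul]
        exact (congrArg (· * ‖x‖) (hφ a)).le }
  let ψ : K →ₐ[ℚ_[p]] C := { φ with commutes' := fun _ => rfl }
  exact (LinearMap.range ψ.toLinearMap).closed_of_finiteDimensional

/-- Ax–Sen–Tate: for `K` a finite extension of `ℚ_p`, `C` the completion of an algebraic
closure `K̄` of `K` (formalized as a complete nonarchimedean normed field together with a
dense isometric embedding `ι : K̄ → C` extending the `p`-adic norm), and the action of
`G_K = Gal(K̄/K)` on `C` given by the unique continuous extension `ρ` of the Galois action
on `K̄`, the fixed field of `G_K` in `C` is exactly `K`: `C^{G_K} = K`. -/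
theorem completion_fixed_field_eq_base (p : ℕ) [Fact p.Prime]
    (K : Type*) [Field K] [Algebra ℚ_[p] K] [FiniteDimensional ℚ_[p] K]
    (C : Type*) [NormedField C] [CompleteSpace C] [IsUltrametricDist C]
    (ι : AlgebraicClosure K →+* C) (hdense : DenseRange ι)
    (hext : ∀ a : ℚ_[p],
      ‖ι (algebraMap K (AlgebraicClosure K) (algebraMap ℚ_[p] K a))‖ = ‖a‖)
    (ρ : (AlgebraicClosure K ≃ₐ[K] AlgebraicClosure K) →* (C ≃+* C))
    (hcont : ∀ σ, Continuous (ρ σ))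
    (hcompat : ∀ σ x, ρ σ (ι x) = ι (σ x)) :
    {x : C | ∀ σ : AlgebraicClosure K ≃ₐ[K] AlgebraicClosure K, ρ σ x = x} =
      Set.range (fun a : K => ι (algebraMap K (AlgebraicClosure K) a)) := by
  have hp : 1 < p := (Fact.out : p.Prime).one_lt
  let : NormedField (AlgebraicClosure K) := NormedField.induced _ C ι ι.injective
  have hι (y : AlgebraicClosure K) : ‖ι y‖ = ‖y‖ := rfl
  have : IsUltrametricDist (AlgebraicClosure K) :=
    IsUltrametricDist.isUltrametricDist_of_forall_norm_add_le_max_norm fun y z => by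
      rw [← hι, ← hι, ← hι, map_add]
      exact IsUltrametricDist.norm_add_le_max _ _
  let : NormedAlgebra ℚ_[p] (AlgebraicClosure K) :=
    { norm_smul_le := fun a y => by
        rw [Algebra.smul_def, norm_mul, IsScalarTower.algebraMap_apply ℚ_[p] K, ← hι, hext] }
  have : Algebra.IsAlgebraic ℚ_[p] (AlgebraicClosure K) := Algebra.IsAlgebraic.trans ℚ_[p] K _
  have : CharZero K := charZero_of_injective_algebraMap (algebraMap ℚ_[p] K).injective
  have hρ (σ : AlgebraicClosure K ≃ₐ[K] AlgebraicClosure K) (x : C) : ‖ρ σ x‖ = ‖x‖ := by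
    refine congrFun (hdense.equalizer (continuous_norm.comp (hcont σ)) continuous_norm ?_) x
    funext y
    simp only [Function.comp_apply, hcompat, hι]
    exact norm_algEquiv_apply (p := p) σ y
  ext x
  constructor
  · intro hx
    have hclosed : IsClosed (Set.range (ι.comp (algebraMap K (AlgebraicClosure K)))) :=
      isClosed_range_of_norm_extends (p := p) _ hext
    refine hclosed.closure_subset_iff.2 subset_rfl (Metric.mem_closure_iff.2 fun ε hε => ?_)
    have hpp : (1 : ℝ) ≤ (p : ℝ) ^ 2 := one_le_pow₀ (by exact_mod_cast hp.le)
    obtain ⟨y, hy⟩ := Metric.denseRange_iff.1 hdense x (ε / (p : ℝ) ^ 2) (by positivity)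
    rw [dist_eq_norm] at hy
    have hmove (σ : AlgebraicClosure K ≃ₐ[K] AlgebraicClosure K) : ‖σ y - y‖ ≤ ‖x - ι y‖ := by
      have h : ι (σ y - y) = (x - ι y) + -ρ σ (x - ι y) := by
        rw [map_sub, map_sub (ρ σ), hcompat, hx σ]
        ring
      rw [← hι, h]
      exact (IsUltrametricDist.norm_add_le_max _ _).trans
        (max_le le_rfl ((norm_neg _).trans (hρ σ _)).le)
    obtain ⟨a, ha⟩ := exists_norm_sub_algebraMap_le p hmove
    have hlt : (p : ℝ) ^ 2 * ‖x - ι y‖ < ε := by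
      rwa [lt_div_iff₀' (by positivity)] at hy
    refine ⟨_, ⟨a, rfl⟩, lt_of_le_of_lt ?_ hlt⟩
    rw [dist_eq_norm, ← sub_add_sub_cancel x (ι y), RingHom.comp_apply, ← map_sub]
    exact (IsUltrametricDist.norm_add_le_max _ _).trans
      (max_le (le_mul_of_one_le_left (norm_nonneg _) hpp)
        (ha.trans (mul_le_mul_of_nonneg_right (axConstant_le hp _) (norm_nonneg _))))
  · rintro ⟨a, rfl⟩ σ
    rw [hcompat, AlgEquiv.commutes]
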